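/- Theorem 3: Suppose Assumption 2 and Assumption 3 hold and 1/(2n) < h ≤ 1/n, and in addition: (i) there exists a partially stubborn agent i (0 < ξᵢ < 1) such that for every other partially stubborn agent j there is m ≥ 1 with ((ΞW)^m) j i > 0 (a directed path from i to j in G(W) all of whose vertices other than i are partially stubborn or non-stubborn); (ii) the undirected graph on the fully stubborn agents, with an edge between distinct fully stubborn i and j iff j ∈ N_i(0), is connected; (iii) there exist a partially stubborn agent i and a fully stubborn agent j with j ∈ N_i(0). Then the bounded-confidence issue-sequence dynamics achieves opinion consensus: for every x(0) ∈ ℝⁿ there exists χ ∈ ℝ such that lim_{s→∞} x(s) = χ·1, where 1 is the all-ones vector. -/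

import Mathlib

open Matrix Filter Finset

/-- `Nb y d i` is the set of agents within confidence distance `d` of agent `i`. -/
noncomputable def Nb {n : ℕ} (y : Fin n → ℝ) (d : ℝ) (i : Fin n) : Finset (Fin n) :=
  Finset.univ.filter fun l => |y i - y l| < d

/-- One bounded-confidence averaging step: `x i = y i + h ∑_{l ∈ N_i} (y l - y i)`. -/
noncomputable def bcStep {n : ℕ} (y : Fin n → ℝ) (d h : ℝ) (i : Fin n) : ℝ :=
  y i + h * ∑ l ∈ Nb y d i, (y l - y i)

/-- Bounded-confidence issue-sequence opinions: `x(0) = x0` and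
`x(s+1) i = y(s) i + h ∑_{j ∈ N_i(s)} (y(s) j - y(s) i)` with `y(s) = Ψ x(s)`. -/
noncomputable def bcX {n : ℕ} (Ψ : Matrix (Fin n) (Fin n) ℝ) (h d : ℝ)
    (x0 : Fin n → ℝ) : ℕ → Fin n → ℝ
  | 0 => x0
  | s + 1 => bcStep (Ψ.mulVec (bcX Ψ h d x0 s)) d h

/-- Ultimate opinions for issue `s`: `y(s) = Ψ x(s)`. -/
noncomputable def bcY {n : ℕ} (Ψ : Matrix (Fin n) (Fin n) ℝ) (h d : ℝ)
    (x0 : Fin n → ℝ) (s : ℕ) : Fin n → ℝ :=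
  Ψ.mulVec (bcX Ψ h d x0 s)

/-- `S` is an independent strongly connected component of the influence graph `G(W)`. -/
def IsISCC {n : ℕ} (W : Matrix (Fin n) (Fin n) ℝ) (S : Set (Fin n)) : Prop :=
  S.Nonempty ∧ (∀ i ∈ S, ∀ j, W i j ≠ 0 → j ∈ S) ∧
    (∀ i ∈ S, ∀ j ∈ S, i ≠ j → ∃ m, 1 ≤ m ∧ 0 < (W ^ m) i j)

/-- Assumption 2: every ISCC of `G(W)` contains at least one stubborn agent. -/
def Assumption2 {n : ℕ} (W : Matrix (Fin n) (Fin n) ℝ) (ξ : Fin n → ℝ) : Prop :=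
  ∀ S : Set (Fin n), IsISCC W S → ∃ i ∈ S, ξ i < 1

section Auxiliary

variable {n : ℕ}

/-! ### Reachability of consensus for products of stochastic matrices -/

section Consensus

variable {ι : Type*} [Fintype ι]

lemma le_stochastic_mulVec [DecidableEq ι] {P : Matrix ι ι ℝ} (hP : P ∈ rowStochastic ℝ ι)
    {v : ι → ℝ} {a : ℝ} (hv : ∀ j, a ≤ v j) (i j : ι) :
    a + P i j * (v j - a) ≤ (P *ᵥ v) i := by
  have h0 : ∀ i j, 0 ≤ P i j := hP.1
  have h1 : ∑ l, P i l = 1 := by simpa [mulVec, dotProduct] using congrFun hP.2 i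
  have h2 : P i j * (v j - a) ≤ ∑ l, P i l * (v l - a) :=
    Finset.single_le_sum (f := fun l => P i l * (v l - a))
      (fun l _ => mul_nonneg (h0 i l) (sub_nonneg.2 (hv l))) (Finset.mem_univ j)
  have h3 : ∑ l, P i l * (v l - a) = (P *ᵥ v) i - a := by
    simp only [mul_sub, Finset.sum_sub_distrib, ← Finset.sum_mul, h1, mulVec, dotProduct, one_mul]
  linarith

lemma le_of_stochastic_orbit [DecidableEq ι] {P : ℕ → Matrix ι ι ℝ}
    (hP : ∀ s, P s ∈ rowStochastic ℝ ι) {x : ℕ → ι → ℝ} (hx : ∀ s, x (s + 1) = P s *ᵥ x s)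
    {s : ℕ} {a : ℝ} (ha : ∀ j, a ≤ x s j) (k : ℕ) (i : ι) : a ≤ x (s + k) i := by
  induction k generalizing i with
  | zero => exact ha i
  | succ k ih =>
    have h1 := le_stochastic_mulVec (hP (s + k)) ih i i
    have h2 := mul_nonneg ((hP (s + k)).1 i i) (sub_nonneg.2 (ih i))
    rw [← add_assoc, hx]
    linarith

/-- After `k` steps, agent `i` puts a weight on agent `r` that is bounded below uniformly in time. -/
def UniformInfluence (P : ℕ → Matrix ι ι ℝ) (r i : ι) (k : ℕ) : Prop :=
  ∃ c > 0, ∀ x : ℕ → ι → ℝ, (∀ s, x (s + 1) = P s *ᵥ x s) →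
    ∀ s a, (∀ j, a ≤ x s j) → a + c * (x s r - a) ≤ x (s + k) i

lemma UniformInfluence.step [DecidableEq ι] {P : ℕ → Matrix ι ι ℝ}
    (hP : ∀ s, P s ∈ rowStochastic ℝ ι)
    {r i j : ι} {k : ℕ} {ε : ℝ} (hε : 0 < ε) (hij : ∀ s, ε ≤ P s i j)
    (hj : UniformInfluence P r j k) : UniformInfluence P r i (k + 1) := by
  obtain ⟨c, hc, H⟩ := hj
  refine ⟨ε * c, mul_pos hε hc, fun x hx s a ha => ?_⟩
  have h1 := le_stochastic_mulVec (hP (s + k)) (le_of_stochastic_orbit hP hx ha k) i j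
  have h2 : c * (x s r - a) ≤ x (s + k) j - a := by linarith [H x hx s a ha]
  have h3 : 0 ≤ c * (x s r - a) := mul_nonneg hc.le (sub_nonneg.2 (ha r))
  have h4 := mul_le_mul (hij (s + k)) h2 h3 ((hP (s + k)).1 i j)
  rw [← add_assoc, hx]
  linarith [mul_assoc ε c (x s r - a)]

/-- Time-varying averaging over a fixed rooted graph whose root has a self-loop, with weights
bounded below along the edges, converges to consensus. -/
theorem tendsto_consensus_of_rooted [DecidableEq ι] {P : ℕ → Matrix ι ι ℝ}
    (hP : ∀ s, P s ∈ rowStochastic ℝ ι) (E : ι → ι → Prop)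
    (hE : ∀ i j, E i j → ∃ ε > 0, ∀ s, ε ≤ P s i j) (r : ι) (hr : E r r)
    (hreach : ∀ i, Relation.ReflTransGen E i r)
    {x : ℕ → ι → ℝ} (hx : ∀ s, x (s + 1) = P s *ᵥ x s) :
    ∃ χ : ℝ, ∀ i, Tendsto (fun s => x s i) atTop (nhds χ) := by
  have hstep : ∀ i j k, E i j → UniformInfluence P r j k → UniformInfluence P r i (k + 1) := by
    intro i j k hij hj
    obtain ⟨ε, hε, hb⟩ := hE i j hij
    exact hj.step hP hε hb
  have hroot : ∀ k, UniformInfluence P r r k := by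
    intro k
    induction k with
    | zero => exact ⟨1, one_pos, fun x _ s a _ => by simp⟩
    | succ k ih => exact hstep r r k hr ih
  have hev : ∀ i, ∀ᶠ k in atTop, UniformInfluence P r i k := by
    intro i
    induction hreach i using Relation.ReflTransGen.head_induction_on with
    | refl => exact Eventually.of_forall hroot
    | head hij _ ih =>
      obtain ⟨K, hK⟩ := eventually_atTop.1 ih
      refine eventually_atTop.2 ⟨K + 1, fun k hk => ?_⟩
      obtain ⟨k, rfl⟩ := Nat.exists_eq_add_of_le' (le_trans (Nat.le_add_left 1 K) hk)
      exact hstep _ _ k hij (hK k (by omega))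
  obtain ⟨m, hm⟩ := (eventually_all.2 hev).exists
  choose c hc H using hm
  have : Nonempty ι := ⟨r⟩
  obtain ⟨i₀, hi₀⟩ := Finite.exists_min c
  have hxneg : ∀ s, (fun s => -x s) (s + 1) = P s *ᵥ (fun s => -x s) s := by
    intro s
    simp only [hx s, mulVec_neg]
  let lo : ℕ → ℝ := fun s => ⨅ i, x s i
  let hi : ℕ → ℝ := fun s => ⨆ i, x s i
  have hlo : ∀ s i, lo s ≤ x s i := fun s i => ciInf_le (Set.finite_range _).bddBelow i
  have hhi : ∀ s i, x s i ≤ hi s := fun s i => le_ciSup (Set.finite_range _).bddAbove i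
  have hmono : Monotone lo := monotone_nat_of_le_succ fun s =>
    le_ciInf (le_of_stochastic_orbit hP hx (hlo s) 1)
  have hanti : Antitone hi := antitone_nat_of_succ_le fun s => ciSup_le fun i => by
    have := le_of_stochastic_orbit hP (x := fun s => -x s) hxneg (s := s) (a := -hi s)
      (fun j => neg_le_neg (hhi s j)) 1 i
    exact neg_le_neg_iff.1 this
  have hlohi : ∀ s t, lo s ≤ hi t := fun s t =>
    (hmono (le_max_left s t)).trans <|
      ((hlo _ r).trans (hhi _ r)).trans (hanti (le_max_right s t))
  have hlim_lo := tendsto_atTop_ciSup hmono ⟨hi 0, by rintro _ ⟨s, rfl⟩; exact hlohi s 0⟩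
  have hlim_hi := tendsto_atTop_ciInf hanti ⟨lo 0, by rintro _ ⟨s, rfl⟩; exact hlohi 0 s⟩
  have hcontr : ∀ s, hi (s + m) - lo (s + m) ≤ (1 - c i₀) * (hi s - lo s) := by
    intro s
    have h1 : lo s + c i₀ * (x s r - lo s) ≤ lo (s + m) := le_ciInf fun i => by
      have h2 := H i x hx s (lo s) (hlo s)
      have h3 := mul_le_mul_of_nonneg_right (hi₀ i) (sub_nonneg.2 (hlo s r))
      linarith
    have h4 : hi (s + m) ≤ hi s - c i₀ * (hi s - x s r) := ciSup_le fun i => by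
      have h2 := H i (fun s => -x s) hxneg s (-hi s) (fun j => neg_le_neg (hhi s j))
      have h3 := mul_le_mul_of_nonneg_right (hi₀ i) (sub_nonneg.2 (hhi s r))
      simp only [Pi.neg_apply] at h2
      linarith
    linarith
  have hle := le_of_tendsto_of_tendsto'
    (((tendsto_add_atTop_iff_nat m).2 hlim_hi).sub ((tendsto_add_atTop_iff_nat m).2 hlim_lo))
    ((hlim_hi.sub hlim_lo).const_mul (1 - c i₀)) hcontr
  have hge := ge_of_tendsto' (hlim_hi.sub hlim_lo) (fun s => sub_nonneg.2 (hlohi s s))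
  have heq : (⨅ s, hi s) = ⨆ s, lo s := by nlinarith [hc i₀]
  rw [heq] at hlim_hi
  exact ⟨_, fun i => tendsto_of_tendsto_of_tendsto_of_le_of_le hlim_lo hlim_hi
    (fun s => hlo s i) (fun s => hhi s i)⟩

end Consensus

/-! ### The resolvent `(1 - ΞW)⁻¹` -/

section Resolvent

variable {W : Matrix (Fin n) (Fin n) ℝ} {ξ : Fin n → ℝ}

lemma exists_isISCC_subset (hW0 : ∀ i j, 0 ≤ W i j) (hW1 : ∀ i, ∑ j, W i j = 1)
    {S : Set (Fin n)} (hS : S.Nonempty) (hcl : ∀ i ∈ S, ∀ j, W i j ≠ 0 → j ∈ S) :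
    ∃ T ⊆ S, IsISCC W T := by
  obtain ⟨T, hTS, hT⟩ := exists_minimal_le_of_wellFoundedLT
    (fun T : Set (Fin n) => T.Nonempty ∧ ∀ i ∈ T, ∀ j, W i j ≠ 0 → j ∈ T) S ⟨hS, hcl⟩
  refine ⟨T, hTS, hT.prop.1, hT.prop.2, fun i hi j hj _ => ?_⟩
  have hpow : ∀ m i j, 0 ≤ (W ^ m) i j := by
    intro m
    induction m with
    | zero => intro i j; simp only [pow_zero, one_apply]; split_ifs <;> norm_num
    | succ m ih =>
      intro i j
      rw [pow_succ, mul_apply]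
      exact Finset.sum_nonneg fun l _ => mul_nonneg (ih i l) (hW0 l j)
  have hpowT : ∀ m, ∀ l, 0 < (W ^ m) i l → l ∈ T := by
    intro m
    induction m with
    | zero =>
      intro l hl
      rw [pow_zero, one_apply] at hl
      split_ifs at hl with h
      · exact h ▸ hi
      · exact absurd hl (lt_irrefl _)
    | succ m ih =>
      intro l hl
      rw [pow_succ, mul_apply] at hl
      obtain ⟨k, -, hk⟩ := Finset.exists_ne_zero_of_sum_ne_zero hl.ne'
      exact hT.prop.2 k (ih k ((hpow m i k).lt_of_ne' (left_ne_zero_of_mul hk))) l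
        (right_ne_zero_of_mul hk)
  have hR : ({l | ∃ m, 1 ≤ m ∧ 0 < (W ^ m) i l} : Set (Fin n)).Nonempty ∧
      ∀ k ∈ ({l | ∃ m, 1 ≤ m ∧ 0 < (W ^ m) i l} : Set (Fin n)), ∀ l, W k l ≠ 0 →
        l ∈ ({l | ∃ m, 1 ≤ m ∧ 0 < (W ^ m) i l} : Set (Fin n)) := by
    constructor
    · obtain ⟨k, -, hk⟩ := Finset.exists_ne_zero_of_sum_ne_zero
        (show ∑ j, W i j ≠ 0 by rw [hW1]; exact one_ne_zero)
      exact ⟨k, 1, le_rfl, by rw [pow_one]; exact (hW0 i k).lt_of_ne' hk⟩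
    · rintro k ⟨m, _, hk⟩ l hl
      refine ⟨m + 1, by omega, ?_⟩
      rw [pow_succ, mul_apply]
      exact Finset.sum_pos' (fun p _ => mul_nonneg (hpow m i p) (hW0 p l))
        ⟨k, Finset.mem_univ k, mul_pos hk ((hW0 k l).lt_of_ne' hl)⟩
  exact hT.le_of_le hR (fun l ⟨m, _, hl⟩ => hpowT m l hl) hj

/-- Minimum principle for `1 - ΞW`. -/
lemma nonneg_of_susceptible_mean_le (hW0 : ∀ i j, 0 ≤ W i j) (hW1 : ∀ i, ∑ j, W i j = 1)
    (hξ : ∀ i, 0 ≤ ξ i ∧ ξ i ≤ 1) (hA2 : Assumption2 W ξ) {v : Fin n → ℝ}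
    (hv : ∀ i, ξ i * ∑ j, W i j * v j ≤ v i) (i : Fin n) : 0 ≤ v i := by
  by_contra! hneg
  have : Nonempty (Fin n) := ⟨i⟩
  obtain ⟨i₀, hmin⟩ := Finite.exists_min v
  have hμ : v i₀ < 0 := (hmin i).trans_lt hneg
  have hsum : ∀ k, v i₀ + ∑ j, W k j * (v j - v i₀) = ∑ j, W k j * v j := by
    intro k
    simp only [mul_sub, Finset.sum_sub_distrib, ← Finset.sum_mul, hW1]
    ring
  have hterm : ∀ k j, 0 ≤ W k j * (v j - v i₀) := fun k j =>
    mul_nonneg (hW0 k j) (sub_nonneg.2 (hmin j))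
  have hsn : ∀ k, 0 ≤ ∑ j, W k j * (v j - v i₀) := fun k =>
    Finset.sum_nonneg fun j _ => hterm k j
  have hone : ∀ k, v k = v i₀ → ξ k = 1 := by
    intro k hk
    have h1 := hv k
    rw [← hsum, hk] at h1
    nlinarith [mul_nonneg (hξ k).1 (hsn k), (hξ k).2]
  obtain ⟨T, hTS, hT⟩ := exists_isISCC_subset hW0 hW1 (S := {k | v k = v i₀}) ⟨i₀, rfl⟩ <| by
    intro k hk j hj
    have h1 := hv k
    rw [← hsum, hone k hk, show v k = v i₀ from hk] at h1
    have h2 : ∑ j, W k j * (v j - v i₀) = 0 := le_antisymm (by linarith) (hsn k)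
    have h3 := (Finset.sum_eq_zero_iff_of_nonneg fun j _ => hterm k j).1 h2 j (Finset.mem_univ j)
    exact sub_eq_zero.1 ((mul_eq_zero.1 h3).resolve_left hj)
  obtain ⟨k, hk, hlt⟩ := hA2 T hT
  exact hlt.ne (hone k (hTS hk))

lemma one_sub_diagonal_mul_mulVec (v : Fin n → ℝ) (i : Fin n) :
    ((1 - diagonal ξ * W) *ᵥ v) i = v i - ξ i * ∑ j, W i j * v j := by
  rw [sub_mulVec, one_mulVec, ← mulVec_mulVec, Pi.sub_apply, mulVec_diagonal]
  rfl

lemma isUnit_one_sub_diagonal_mul (hW0 : ∀ i j, 0 ≤ W i j) (hW1 : ∀ i, ∑ j, W i j = 1)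
    (hξ : ∀ i, 0 ≤ ξ i ∧ ξ i ≤ 1) (hA2 : Assumption2 W ξ) :
    IsUnit (1 - diagonal ξ * W) := by
  have key : ∀ v, (1 - diagonal ξ * W) *ᵥ v = 0 → ∀ i, 0 ≤ v i := fun v hv =>
    nonneg_of_susceptible_mean_le hW0 hW1 hξ hA2 fun i => by
      have := congrFun hv i
      rw [one_sub_diagonal_mul_mulVec, Pi.zero_apply] at this
      linarith
  rw [← mulVec_injective_iff_isUnit]
  intro v w hvw
  have h1 : (1 - diagonal ξ * W) *ᵥ (v - w) = 0 := by rw [mulVec_sub]; exact sub_eq_zero.2 hvw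
  have h2 : (1 - diagonal ξ * W) *ᵥ (w - v) = 0 := by rw [mulVec_sub]; exact sub_eq_zero.2 hvw.symm
  funext i
  have h3 := key _ h1 i
  have h4 := key _ h2 i
  simp only [Pi.sub_apply] at h3 h4
  linarith

lemma resolvent_nonneg (hW0 : ∀ i j, 0 ≤ W i j) (hW1 : ∀ i, ∑ j, W i j = 1)
    (hξ : ∀ i, 0 ≤ ξ i ∧ ξ i ≤ 1) (hA2 : Assumption2 W ξ) (i j : Fin n) :
    0 ≤ (1 - diagonal ξ * W)⁻¹ i j := by
  have hu := (isUnit_iff_isUnit_det _).1 (isUnit_one_sub_diagonal_mul hW0 hW1 hξ hA2)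
  refine nonneg_of_susceptible_mean_le hW0 hW1 hξ hA2
    (v := fun k => (1 - diagonal ξ * W)⁻¹ k j) (fun k => ?_) i
  have h1 := congrFun (congrFun (mul_nonsing_inv _ hu) k) j
  have h2 := one_sub_diagonal_mul_mulVec (W := W) (ξ := ξ)
    (fun k => (1 - diagonal ξ * W)⁻¹ k j) k
  have h3 : (0 : ℝ) ≤ (1 : Matrix (Fin n) (Fin n) ℝ) k j := by
    rw [one_apply]; split_ifs <;> norm_num
  rw [← h1] at h3
  change ((1 - diagonal ξ * W) * (1 - diagonal ξ * W)⁻¹) k j = _ at h2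
  linarith

lemma resolvent_eq (hW0 : ∀ i j, 0 ≤ W i j) (hW1 : ∀ i, ∑ j, W i j = 1)
    (hξ : ∀ i, 0 ≤ ξ i ∧ ξ i ≤ 1) (hA2 : Assumption2 W ξ) :
    (1 - diagonal ξ * W)⁻¹ = 1 + diagonal ξ * W * (1 - diagonal ξ * W)⁻¹ := by
  have hu := (isUnit_iff_isUnit_det _).1 (isUnit_one_sub_diagonal_mul hW0 hW1 hξ hA2)
  have h1 := mul_nonsing_inv _ hu
  rw [Matrix.sub_mul, Matrix.one_mul] at h1
  exact sub_eq_iff_eq_add.1 h1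

lemma pow_le_resolvent (hW0 : ∀ i j, 0 ≤ W i j) (hW1 : ∀ i, ∑ j, W i j = 1)
    (hξ : ∀ i, 0 ≤ ξ i ∧ ξ i ≤ 1) (hA2 : Assumption2 W ξ) (m : ℕ) (i j : Fin n) :
    ((diagonal ξ * W) ^ m) i j ≤ (1 - diagonal ξ * W)⁻¹ i j := by
  have hA : ∀ i j, 0 ≤ (diagonal ξ * W) i j := fun i j => by
    rw [diagonal_mul]; exact mul_nonneg (hξ i).1 (hW0 i j)
  have hN := resolvent_nonneg hW0 hW1 hξ hA2
  induction m generalizing i j with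
  | zero =>
    rw [resolvent_eq hW0 hW1 hξ hA2, pow_zero, Matrix.add_apply, mul_apply]
    exact le_add_of_nonneg_right (Finset.sum_nonneg fun l _ => mul_nonneg (hA i l) (hN l j))
  | succ m ih =>
    rw [resolvent_eq hW0 hW1 hξ hA2, pow_succ', Matrix.add_apply, mul_apply, mul_apply]
    refine le_add_of_nonneg_of_le ?_ (Finset.sum_le_sum fun l _ =>
      mul_le_mul_of_nonneg_left (ih l j) (hA i l))
    rw [one_apply]; split_ifs <;> norm_num

lemma control_apply (i j : Fin n) : ((1 - diagonal ξ * W)⁻¹ * (1 - diagonal ξ)) i j =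
    (1 - diagonal ξ * W)⁻¹ i j * (1 - ξ j) := by
  rw [Matrix.mul_sub, Matrix.mul_one, Matrix.sub_apply, mul_diagonal]
  ring

lemma control_mem_rowStochastic (hW0 : ∀ i j, 0 ≤ W i j) (hW1 : ∀ i, ∑ j, W i j = 1)
    (hξ : ∀ i, 0 ≤ ξ i ∧ ξ i ≤ 1) (hA2 : Assumption2 W ξ) :
    (1 - diagonal ξ * W)⁻¹ * (1 - diagonal ξ) ∈ rowStochastic ℝ (Fin n) := by
  refine ⟨fun i j => ?_, ?_⟩
  · rw [control_apply]
    exact mul_nonneg (resolvent_nonneg hW0 hW1 hξ hA2 i j) (sub_nonneg.2 (hξ j).2)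
  · have hu := (isUnit_iff_isUnit_det _).1 (isUnit_one_sub_diagonal_mul hW0 hW1 hξ hA2)
    have h1 : (1 - diagonal ξ) *ᵥ (1 : Fin n → ℝ) = (1 - diagonal ξ * W) *ᵥ 1 := by
      funext i
      rw [one_sub_diagonal_mul_mulVec, sub_mulVec, Pi.sub_apply, mulVec_diagonal]
      simp [hW1]
    rw [← mulVec_mulVec, h1, mulVec_mulVec, nonsing_inv_mul _ hu, one_mulVec]

lemma control_of_fully_stubborn (hW0 : ∀ i j, 0 ≤ W i j) (hW1 : ∀ i, ∑ j, W i j = 1)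
    (hξ : ∀ i, 0 ≤ ξ i ∧ ξ i ≤ 1) (hA2 : Assumption2 W ξ) {i : Fin n} (hi : ξ i = 0)
    (j : Fin n) : ((1 - diagonal ξ * W)⁻¹ * (1 - diagonal ξ)) i j = if i = j then 1 else 0 := by
  rw [control_apply, resolvent_eq hW0 hW1 hξ hA2, Matrix.add_apply, Matrix.mul_assoc, diagonal_mul, hi,
    zero_mul, add_zero, one_apply]
  split_ifs with h
  · rw [← h, hi]; norm_num
  · rw [zero_mul]

end Resolvent

/-! ### The bounded-confidence averaging step -/

section ConfidenceStep

/-- The averaging matrix of `bcStep`. -/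
noncomputable def confidenceMatrix (y : Fin n → ℝ) (d h : ℝ) : Matrix (Fin n) (Fin n) ℝ :=
  fun i j => (if i = j then 1 - h * (Nb y d i).card else 0) + if j ∈ Nb y d i then h else 0

lemma confidenceMatrix_mulVec (y v : Fin n → ℝ) (d h : ℝ) (i : Fin n) :
    (confidenceMatrix y d h *ᵥ v) i = v i + h * ∑ l ∈ Nb y d i, (v l - v i) := by
  simp only [mulVec, dotProduct, confidenceMatrix, add_mul, ite_mul, zero_mul,
    Finset.sum_add_distrib, Finset.sum_ite_eq, Finset.mem_univ, if_true, Finset.sum_ite_mem,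
    Finset.univ_inter, Finset.sum_sub_distrib, Finset.sum_const, nsmul_eq_mul, ← Finset.mul_sum]
  ring

lemma mul_card_le_one {h : ℝ} (h0 : 0 ≤ h) (hn : h * n ≤ 1) (s : Finset (Fin n)) :
    h * s.card ≤ 1 := by
  have h1 : (s.card : ℝ) ≤ n := by exact_mod_cast s.card_le_univ.trans_eq (Fintype.card_fin n)
  exact (mul_le_mul_of_nonneg_left h1 h0).trans hn

lemma confidenceMatrix_mem_rowStochastic (y : Fin n → ℝ) (d : ℝ) {h : ℝ} (h0 : 0 ≤ h)
    (hn : h * n ≤ 1) : confidenceMatrix y d h ∈ rowStochastic ℝ (Fin n) := by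
  refine ⟨fun i j => ?_, ?_⟩
  · have := mul_card_le_one h0 hn (Nb y d i)
    unfold confidenceMatrix
    split_ifs <;> linarith
  · funext i
    rw [confidenceMatrix_mulVec]
    simp

lemma le_confidenceMatrix (y : Fin n → ℝ) (d : ℝ) {h : ℝ} (h0 : 0 ≤ h) (hn : h * n ≤ 1)
    {i j : Fin n} (hj : j ∈ Nb y d i) : h ≤ confidenceMatrix y d h i j := by
  have := mul_card_le_one h0 hn (Nb y d i)
  unfold confidenceMatrix
  rw [if_pos hj]
  split_ifs <;> linarith

lemma mem_Nb {y : Fin n → ℝ} {d : ℝ} {i j : Fin n} : j ∈ Nb y d i ↔ |y i - y j| < d := by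
  simp [Nb]

lemma mem_Nb_comm {y : Fin n → ℝ} {d : ℝ} {i j : Fin n} : j ∈ Nb y d i ↔ i ∈ Nb y d j := by
  rw [mem_Nb, mem_Nb, abs_sub_comm]

lemma abs_bcStep_sub_le {y : Fin n → ℝ} {d h : ℝ} (h0 : 0 ≤ h) (hn : h * n ≤ 1) {i j : Fin n}
    (hij : j ∈ Nb y d i) :
    |bcStep y d h i - bcStep y d h j| ≤
      d * (1 + h * (n - 2 * (Nb y d i ∩ Nb y d j).card)) := by
  set C := Nb y d i ∩ Nb y d j with hC
  have hd : |y i - y j| < d := mem_Nb.1 hij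
  have hd0 : 0 ≤ d := (abs_nonneg _).trans hd.le
  let r : Fin n → ℝ := fun l => (if l ∈ Nb y d i then y l - y i else 0) -
    (if l ∈ Nb y d j then y l - y j else 0) + if l ∈ C then y i - y j else 0
  have hr : ∀ l, |r l| ≤ d - if l ∈ C then d else 0 := by
    intro l
    have hi' : l ∈ Nb y d i → |y l - y i| < d := fun h => by rw [abs_sub_comm]; exact mem_Nb.1 h
    have hj' : l ∈ Nb y d j → |y l - y j| < d := fun h => by rw [abs_sub_comm]; exact mem_Nb.1 h
    by_cases h1 : l ∈ Nb y d i <;> by_cases h2 : l ∈ Nb y d j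
    · simp [r, hC, h1, h2]
    · simpa [r, hC, h1, h2] using (hi' h1).le
    · simpa [r, hC, h1, h2, abs_sub_comm] using (hj' h2).le
    · simpa [r, hC, h1, h2] using hd0
  have hsum : |∑ l, r l| ≤ d * (n - C.card) := by
    refine (Finset.abs_sum_le_sum_abs _ _).trans ((Finset.sum_le_sum fun l _ => hr l).trans_eq ?_)
    rw [Finset.sum_sub_distrib, Finset.sum_ite_mem, Finset.univ_inter]
    simp only [Finset.sum_const, Finset.card_univ, Fintype.card_fin, nsmul_eq_mul]
    ring
  have heq : bcStep y d h i - bcStep y d h j =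
      (1 - h * C.card) * (y i - y j) + h * ∑ l, r l := by
    simp only [bcStep, r, Finset.sum_add_distrib, Finset.sum_sub_distrib (s := Finset.univ),
      Finset.sum_ite_mem, Finset.univ_inter]
    rw [Finset.sum_const, nsmul_eq_mul]
    ring
  have hc := mul_card_le_one h0 hn C
  calc |bcStep y d h i - bcStep y d h j|
      ≤ |(1 - h * C.card) * (y i - y j)| + |h * ∑ l, r l| := heq ▸ abs_add_le _ _
    _ = (1 - h * C.card) * |y i - y j| + h * |∑ l, r l| := by
      rw [abs_mul, abs_mul, abs_of_nonneg h0, abs_of_nonneg (sub_nonneg.2 hc)]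
    _ ≤ (1 - h * C.card) * d + h * (d * (n - C.card)) :=
      add_le_add (mul_le_mul_of_nonneg_left hd.le (sub_nonneg.2 hc))
        (mul_le_mul_of_nonneg_left hsum h0)
    _ = _ := by ring

lemma abs_bcStep_sub_lt {y : Fin n → ℝ} {d h : ℝ} (h0 : 0 < h) (hn : h * n ≤ 1) {i j : Fin n}
    (hij : j ∈ Nb y d i) {t : ℝ}
    (hcard : (n : ℝ) / 2 + t / (2 * h) < (Nb y d i ∩ Nb y d j).card) :
    |bcStep y d h i - bcStep y d h j| < d * (1 - t) := by
  have hd : 0 < d := (abs_nonneg _).trans_lt (mem_Nb.1 hij)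
  refine (abs_bcStep_sub_le h0.le hn hij).trans_lt (mul_lt_mul_of_pos_left ?_ hd)
  have h1 := mul_lt_mul_of_pos_left hcard h0
  have h2 : h * (n / 2 + t / (2 * h)) = h * n / 2 + t / 2 := by field_simp
  linarith

lemma abs_stochastic_mulVec_sub_lt {P : Matrix (Fin n) (Fin n) ℝ}
    (hP : P ∈ rowStochastic ℝ (Fin n)) {v : Fin n → ℝ} {a e : ℝ} {i : Fin n}
    (hv : ∀ l, 0 < P i l → |v l - a| < e) : |(P *ᵥ v) i - a| < e := by
  have h0 : ∀ i j, 0 ≤ P i j := hP.1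
  have h1 : ∑ l, P i l = 1 := by simpa [mulVec, dotProduct] using congrFun hP.2 i
  have h2 : (P *ᵥ v) i - a = ∑ l, P i l * (v l - a) := by
    simp only [mul_sub, Finset.sum_sub_distrib, ← Finset.sum_mul, h1, mulVec, dotProduct, one_mul]
  have hle : ∀ l, P i l * |v l - a| ≤ P i l * e := by
    intro l
    rcases (h0 i l).eq_or_lt with h | h
    · simp [← h]
    · exact mul_le_mul_of_nonneg_left (hv l h).le h.le
  obtain ⟨k, -, hk⟩ := Finset.exists_ne_zero_of_sum_ne_zero
    (show ∑ l, P i l ≠ 0 by rw [h1]; exact one_ne_zero)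
  have hk' := (h0 i k).lt_of_ne' hk
  calc |(P *ᵥ v) i - a| ≤ ∑ l, |P i l * (v l - a)| := h2 ▸ Finset.abs_sum_le_sum_abs _ _
    _ = ∑ l, P i l * |v l - a| := by
      simp only [abs_mul, abs_of_nonneg (h0 _ _)]
    _ < ∑ l, P i l * e := Finset.sum_lt_sum (fun l _ => hle l)
      ⟨k, Finset.mem_univ k, mul_lt_mul_of_pos_left (hv k hk') hk'⟩
    _ = e := by rw [← Finset.sum_mul, h1, one_mul]

end ConfidenceStep

end Auxiliary

/-- Theorem 3: under Assumptions 2 and 3, `1/(2n) < h ≤ 1/n`, and conditions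
(i)–(iii), the bounded-confidence issue-sequence dynamics achieves opinion
consensus. -/
theorem bc_issue_sequence_consensus
    (n : ℕ) (hn : 1 ≤ n)
    (W Ξ : Matrix (Fin n) (Fin n) ℝ) (ξ : Fin n → ℝ)
    (hW0 : ∀ i j, 0 ≤ W i j) (hW1 : ∀ i, ∑ j, W i j = 1)
    (hΞ : Ξ = Matrix.diagonal ξ) (hξ : ∀ i, 0 ≤ ξ i ∧ ξ i ≤ 1)
    (hA2 : Assumption2 W ξ)
    (Ψ : Matrix (Fin n) (Fin n) ℝ) (hΨ : Ψ = (1 - Ξ * W)⁻¹ * (1 - Ξ))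
    (d h : ℝ) (hd : 0 < d)
    (hh1 : 1 / (2 * (n : ℝ)) < h) (hh2 : h ≤ 1 / (n : ℝ))
    (x0 : Fin n → ℝ)
    -- Assumption 3(i):
    (hA3i1 : ∀ i, ξ i = 0 → ∀ j ∈ Nb (bcY Ψ h d x0 0) d i, 0 < ξ j →
      ∀ l, 0 < Ψ j l → l ∈ Nb (bcY Ψ h d x0 0) d i)
    (hA3i2 : ∀ i, 0 < ξ i → ∀ j ∈ Nb (bcY Ψ h d x0 0) d i, 0 < ξ j →
      ∀ l, 0 < Ψ j l →
        l ∈ Nb (bcY Ψ h d x0 0) d j ∧ l ∈ Nb (bcY Ψ h d x0 0) d i)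
    -- Assumption 3(ii):
    (hA3ii1 : ∀ i j, ξ i = 0 → ξ j = 0 → j ∈ Nb (bcY Ψ h d x0 0) d i →
      (n : ℝ) / 2 < ((Nb (bcY Ψ h d x0 0) d i ∩ Nb (bcY Ψ h d x0 0) d j).card : ℝ))
    (hA3ii2 : ∀ i j, 0 < ξ i → j ∈ Nb (bcY Ψ h d x0 0) d i →
      (n : ℝ) / 2 + 1 / (4 * h) <
        ((Nb (bcY Ψ h d x0 0) d i ∩ Nb (bcY Ψ h d x0 0) d j).card : ℝ))
    -- (i): a partially stubborn agent reaching all other partially stubborn agents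
    -- through agents with positive susceptibility:
    (hi : ∃ i, 0 < ξ i ∧ ξ i < 1 ∧
      ∀ j, 0 < ξ j → ξ j < 1 → j ≠ i → ∃ m, 1 ≤ m ∧ 0 < ((Ξ * W) ^ m) j i)
    -- (ii): the graph on fully stubborn agents with edges of G(H(0)) is connected:
    (hii : ∀ i j, ξ i = 0 → ξ j = 0 →
      Relation.ReflTransGen
        (fun a b => a ≠ b ∧ ξ a = 0 ∧ ξ b = 0 ∧ b ∈ Nb (bcY Ψ h d x0 0) d a) i j)
    -- (iii): an edge in G(H(0)) between a partially stubborn and a fully stubborn agent: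
    (hiii : ∃ i j, 0 < ξ i ∧ ξ i < 1 ∧ ξ j = 0 ∧ j ∈ Nb (bcY Ψ h d x0 0) d i) :
    ∃ χ : ℝ, ∀ i, Tendsto (fun s => bcX Ψ h d x0 s i) atTop (nhds χ) := by
  subst hΞ
  have hn0 : (0 : ℝ) < n := by exact_mod_cast hn
  have h0 : 0 < h := lt_trans (by positivity) hh1
  have hhn : h * n ≤ 1 := (le_div_iff₀ hn0).1 hh2
  have hΨs : Ψ ∈ rowStochastic ℝ (Fin n) := hΨ ▸ control_mem_rowStochastic hW0 hW1 hξ hA2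
  have hΨ0 : ∀ i j, 0 ≤ Ψ i j := hΨs.1
  have hΨfull : ∀ i, ξ i = 0 → ∀ j, Ψ i j = if i = j then 1 else 0 := fun i hi j =>
    hΨ ▸ control_of_fully_stubborn hW0 hW1 hξ hA2 hi j
  have hfull : ∀ i, ξ i = 0 → ∀ l, 0 < Ψ i l → l = i := by
    intro i hi l hl
    rw [hΨfull i hi] at hl
    by_contra hne
    rw [if_neg (Ne.symm hne)] at hl
    exact lt_irrefl _ hl
  have hyfull : ∀ i, ξ i = 0 → ∀ s, bcY Ψ h d x0 s i = bcX Ψ h d x0 s i := by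
    intro i hi s
    simp [bcY, mulVec, dotProduct, hΨfull i hi]
  have hself : ∀ i, i ∈ Nb (bcY Ψ h d x0 0) d i := fun i => mem_Nb.2 (by simpa using hd)
  -- confidence edges present at the start are never lost
  have hpers : ∀ s i j, j ∈ Nb (bcY Ψ h d x0 0) d i → j ∈ Nb (bcY Ψ h d x0 s) d i := by
    intro s
    induction s with
    | zero => exact fun i j hj => hj
    | succ s ih =>
      have hcard : ∀ i j, ((Nb (bcY Ψ h d x0 0) d i ∩ Nb (bcY Ψ h d x0 0) d j).card : ℝ) ≤
          ((Nb (bcY Ψ h d x0 s) d i ∩ Nb (bcY Ψ h d x0 s) d j).card : ℝ) := fun i j => by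
        exact_mod_cast Finset.card_le_card (Finset.inter_subset_inter (ih i) (ih j))
      have hpos : ∀ i j, 0 < ξ i → j ∈ Nb (bcY Ψ h d x0 0) d i →
          j ∈ Nb (bcY Ψ h d x0 (s + 1)) d i := by
        intro i j hi hj
        have hclose : ∀ k ∈ Nb (bcY Ψ h d x0 0) d i,
            |bcX Ψ h d x0 (s + 1) k - bcX Ψ h d x0 (s + 1) i| < d * (1 - 1 / 2) := by
          intro k hk
          rw [abs_sub_comm]
          refine abs_bcStep_sub_lt h0 hhn (ih i k hk) (lt_of_eq_of_lt ?_
            ((hA3ii2 i k hi hk).trans_le (hcard i k)))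
          field_simp
          ring
        have hmean : ∀ k ∈ Nb (bcY Ψ h d x0 0) d i,
            |bcY Ψ h d x0 (s + 1) k - bcX Ψ h d x0 (s + 1) i| < d * (1 - 1 / 2) := by
          intro k hk
          refine abs_stochastic_mulVec_sub_lt hΨs fun l hl => hclose l ?_
          rcases (hξ k).1.eq_or_lt with h | h
          · rwa [hfull k h.symm l hl]
          · exact (hA3i2 i hi k hk h l hl).2
        have h1 := abs_lt.1 (hmean i (hself i))
        have h2 := abs_lt.1 (hmean j hj)
        exact mem_Nb.2 (abs_lt.2 ⟨by linarith, by linarith⟩)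
      intro i j hj
      rcases (hξ i).1.eq_or_lt with hi | hi
      · rcases (hξ j).1.eq_or_lt with hj0 | hj0
        · rw [mem_Nb, hyfull i hi.symm, hyfull j hj0.symm]
          refine (abs_bcStep_sub_lt (t := 0) h0 hhn (ih i j hj) ?_).trans_eq (by ring)
          rw [zero_div, add_zero]
          exact (hA3ii1 i j hi.symm hj0.symm hj).trans_le (hcard i j)
        · exact mem_Nb_comm.1 (hpos j i hj0 (mem_Nb_comm.1 hj))
      · exact hpos i j hi hj
  obtain ⟨p, hp0, hp1, hp⟩ := hi
  obtain ⟨q, r, hq0, hq1, hr0, hqr⟩ := hiii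
  have hΨp : ∀ j, 0 < ξ j → ξ j < 1 → 0 < Ψ j p := by
    intro j hj0 hj1
    have hpow : ∃ m, 0 < ((diagonal ξ * W) ^ m) j p := by
      by_cases hjp : j = p
      · exact ⟨0, by simp [hjp]⟩
      · obtain ⟨m, -, hm⟩ := hp j hj0 hj1 hjp
        exact ⟨m, hm⟩
    obtain ⟨m, hm⟩ := hpow
    rw [hΨ, control_apply]
    exact mul_pos (hm.trans_le (pow_le_resolvent hW0 hW1 hξ hA2 m j p)) (sub_pos.2 hp1)
  have hprow : p ∈ Nb (bcY Ψ h d x0 0) d r :=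
    hA3i1 r hr0 q (mem_Nb_comm.1 hqr) hq0 p (hΨp q hq0 hq1)
  let E : Fin n → Fin n → Prop := fun i k => ∃ l ∈ Nb (bcY Ψ h d x0 0) d i, 0 < Ψ l k
  have hEfull : ∀ i k, ξ k = 0 → k ∈ Nb (bcY Ψ h d x0 0) d i → E i k := fun i k hk hik =>
    ⟨k, hik, by rw [hΨfull k hk, if_pos rfl]; exact one_pos⟩
  have hstub : ∀ i, ξ i < 1 → Relation.ReflTransGen E i r := by
    intro i hi1
    rcases (hξ i).1.eq_or_lt with hi0 | hi0
    · exact Relation.ReflTransGen.mono (fun a b hab => hEfull a b hab.2.2.1 hab.2.2.2) _ _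
        (hii i r hi0.symm hr0)
    · exact .head ⟨i, hself i, hΨp i hi0 hi1⟩
        (.single (hEfull p r hr0 (mem_Nb_comm.1 hprow)))
  have hreach : ∀ i, Relation.ReflTransGen E i r := by
    intro i
    have hrow : ∑ l, Ψ i l = 1 := by simpa [mulVec, dotProduct] using congrFun hΨs.2 i
    obtain ⟨l, -, hl⟩ := Finset.exists_ne_zero_of_sum_ne_zero
      (show ∑ l, Ψ i l ≠ 0 by rw [hrow]; exact one_ne_zero)
    refine .head ⟨i, hself i, (hΨ0 i l).lt_of_ne' hl⟩ (hstub l ((hξ l).2.lt_of_ne ?_))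
    intro hl1
    rw [hΨ, control_apply, hl1, sub_self, mul_zero] at hl
    exact hl rfl
  refine tendsto_consensus_of_rooted
    (P := fun s => confidenceMatrix (bcY Ψ h d x0 s) d h * Ψ)
    (fun s => mul_mem (confidenceMatrix_mem_rowStochastic _ d h0.le hhn) hΨs) E ?_ r
    (hEfull r r hr0 (hself r)) hreach fun s => ?_
  · rintro i k ⟨l, hl, hlk⟩
    refine ⟨h * Ψ l k, mul_pos h0 hlk, fun s => ?_⟩
    have hH := (confidenceMatrix_mem_rowStochastic (bcY Ψ h d x0 s) d h0.le hhn).1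
    rw [mul_apply]
    exact (mul_le_mul_of_nonneg_right (le_confidenceMatrix _ d h0.le hhn (hpers s i l hl))
      hlk.le).trans (Finset.single_le_sum
        (f := fun l => confidenceMatrix (bcY Ψ h d x0 s) d h i l * Ψ l k)
        (fun l _ => mul_nonneg (hH i l) (hΨ0 l k)) (Finset.mem_univ l))
  · funext i
    rw [← mulVec_mulVec, confidenceMatrix_mulVec]
    rfl
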